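/- Minimal-order agent lemma (Scenario 2 in the proof of Proposition 4): suppose every agent j ∈ I chooses a strategy a_j ∈ UD_j^{k_j} \ UD_j^{k_j+1} for some finite order k_j ≥ 0, and suppose agent i attains the minimum order, k_i = min_{j∈I} k_j. Then a_i is dominated relative to the singleton {(a_j)_{j≠i}} consisting of the other agents' actual strategy profile; that is, when the aggregation mapping is one-to-one so that each agent recovers the others' actual strategies from prices, the participant using the lowest finite order of reasoning has a tradeable arbitrage opportunity. -/

import Mathlib

open MeasureTheory
open scoped Classical

namespace ArbitrageBeliefs

variable {I : Type*} {A : I → Type*} {S : Type*}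

/-- Splice agent `i`'s strategy `ai` together with a profile `b` of the other
agents' strategies into a full strategy profile. -/
noncomputable def splice (i : I) (ai : A i)
    (b : ∀ j : {j : I // j ≠ i}, A j.1) : ∀ j, A j := fun j =>
  if h : j = i then h.symm ▸ ai else b ⟨j, h⟩

/-- Agent `i`'s strategy `ai` is dominated relative to a set `T` of profiles of
the other agents' strategies: against every profile in `T` there is an
alternative strategy that gives `P`-a.s. weakly higher utility and strictly
higher utility with positive probability. -/
def Dominated [MeasurableSpace S] (P : Measure S)
    (Ui : (∀ j, A j) → S → ℝ) (i : I) (ai : A i)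
    (T : Set (∀ j : {j : I // j ≠ i}, A j.1)) : Prop :=
  ∀ b ∈ T, ∃ ai' : A i,
    (∀ᵐ s ∂P, Ui (splice i ai b) s ≤ Ui (splice i ai' b) s) ∧
    0 < P {s | Ui (splice i ai b) s < Ui (splice i ai' b) s}

/-- The undominated response sets, defined by simultaneous recursion:
`UD P U 0 i = A i` and
`UD P U (k+1) i = {ai ∈ UD P U k i : ai not dominated rel. ∏_{j ≠ i} UD P U k j}`. -/
def UD [MeasurableSpace S] (P : Measure S)
    (U : ∀ i : I, (∀ j, A j) → S → ℝ) : ℕ → ∀ i, Set (A i)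
  | 0 => fun _ => Set.univ
  | (k + 1) => fun i =>
      {ai | ai ∈ UD P U k i ∧
        ¬ Dominated P (U i) i ai {b | ∀ j, b j ∈ UD P U k j.1}}

/-- The product set `∏_{j ≠ i} UD_j^k` of the other agents' undominated
`k`-th order responses. -/
def PiUD [MeasurableSpace S] (P : Measure S)
    (U : ∀ i : I, (∀ j, A j) → S → ℝ) (k : ℕ) (i : I) :
    Set (∀ j : {j : I // j ≠ i}, A j.1) :=
  {b | ∀ j, b j ∈ UD P U k j.1}

/-- The undominated response sets decrease with the order of reasoning. -/
theorem antitone_UD [MeasurableSpace S] (P : Measure S)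
    (U : ∀ i : I, (∀ j, A j) → S → ℝ) (i : I) :
    Antitone fun k => UD P U k i :=
  antitone_nat_of_succ_le fun _ _ h => h.1

/-- Domination relative to a set passes to subsets. -/
theorem Dominated.mono [MeasurableSpace S] {P : Measure S}
    {Ui : (∀ j, A j) → S → ℝ} {i : I} {ai : A i}
    {T T' : Set (∀ j : {j : I // j ≠ i}, A j.1)} (hT : T' ⊆ T)
    (h : Dominated P Ui i ai T) : Dominated P Ui i ai T' :=
  fun b hb => h b (hT hb)

/-- minimal-order agent lemma: if every agent `j` chooses a strategy
of exact order `k j` and agent `i` attains the minimal order, then `a i` is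
dominated relative to the singleton consisting of the others' actual profile:
the lowest-order participant has a tradeable arbitrage opportunity. -/
theorem minimal_order_has_arbitrage [Fintype I] [∀ i, Nonempty (A i)]
    [MeasurableSpace S] (P : Measure S) [IsProbabilityMeasure P]
    (U : ∀ i : I, (∀ j, A j) → S → ℝ)
    (hU : ∀ (i : I) (a : ∀ j, A j), Measurable (U i a))
    (a : ∀ i, A i) (k : I → ℕ)
    (ha : ∀ j, a j ∈ UD P U (k j) j \ UD P U (k j + 1) j)
    (i : I) (hmin : ∀ j, k i ≤ k j) :
    Dominated P (U i) i (a i)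
      {fun j : {j : I // j ≠ i} => a j.1} := by
  have hdom : Dominated P (U i) i (a i) {b | ∀ j, b j ∈ UD P U (k i) j.1} :=
    by_contra fun h => (ha i).2 ⟨(ha i).1, h⟩
  refine hdom.mono (Set.singleton_subset_iff.2 ?_)
  exact fun j => antitone_UD P U j.1 (hmin j.1) (ha j.1).1

end ArbitrageBeliefs
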